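/- arXiv:1409.4940 — 3 statements merged into one kernel-verified Lean document; each statement's English description precedes it below -/
import Mathlib

section
/- Assume GCH. Let 𝒞 be a set of regular infinite cardinals, F a function assigning a cardinal F(κ) to each κ ∈ 𝒞, ℙ the associated Easton product, and θ a regular infinite cardinal. Then the sub-poset ℙ^{≤θ} of conditions supported on 𝒞 ∩ (θ+1) satisfies the θ⁺-chain condition: every set of pairwise incompatible conditions in ℙ^{≤θ} has cardinality at most θ. -/
open Cardinal

/-- The Cohen poset `Add(κ, λ)`: conditions are partial functions from `κ × λ` to `{0,1}`
(coded as functional sets of pairs) whose domain has cardinality `< κ`; a condition `q`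
extends `p` iff `q ⊇ p`. -/
def CohenPoset (κ lam : Cardinal) : Set (Set ((κ.out × lam.out) × Bool)) :=
  {p | (∀ a b₁ b₂, (a, b₁) ∈ p → (a, b₂) ∈ p → b₁ = b₂) ∧ #(Prod.fst '' p) < κ}

/-- The Easton product of the posets `Add(κ, F κ)` for `κ ∈ C`: conditions are choices of
a Cohen condition in `Add(κ, F κ)` for each `κ ∈ C` (trivial outside `C`), whose support
`spt p = {κ ∈ C | p κ ≠ ∅}` satisfies `|spt p ∩ θ| < θ` for every regular cardinal `θ`.
The order is coordinatewise extension (reverse inclusion). -/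
def EastonProduct (C : Set Cardinal.{0}) (F : Cardinal.{0} → Cardinal.{0}) :
    Set ((κ : Cardinal.{0}) → Set ((κ.out × (F κ).out) × Bool)) :=
  {p | (∀ κ ∈ C, p κ ∈ CohenPoset κ (F κ)) ∧ (∀ κ, κ ∉ C → p κ = ∅) ∧
       ∀ θ : Cardinal, θ.IsRegular →
         #{κ : Cardinal.{0} // κ ∈ C ∧ p κ ≠ ∅ ∧ κ < θ} < Cardinal.lift.{1} θ}

/-- The conditions of the Easton product whose support is contained in `S`. -/
def EastonSupported (C : Set Cardinal.{0}) (F : Cardinal.{0} → Cardinal.{0}) (S : Set Cardinal) :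
    Set ((κ : Cardinal.{0}) → Set ((κ.out × (F κ).out) × Bool)) :=
  {p ∈ EastonProduct C F | ∀ κ, p κ ≠ ∅ → κ ∈ S}

open Set

universe u

/-- A subset of size `< θ` of the initial ordinal of a regular cardinal `θ` is strictly bounded. -/
theorem Cardinal.IsRegular.exists_forall_lt {θ : Cardinal.{u}} (hθ : θ.IsRegular)
    (s : Set θ.ord.ToType) (hs : #s < θ) : ∃ a, ∀ x ∈ s, x < a := by
  by_contra! h
  have hcof : IsCofinal s := h
  have := Order.cof_le hcof
  rw [Ordinal.cof_toType, hθ.cof_ord] at this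
  exact this.not_gt hs

theorem Cardinal.mk_Iio_toType_lt {c : Cardinal.{u}} (a : c.ord.ToType) : #(Iio a) < c := by
  simpa only [mk_ord_toType] using mk_Iio_lt a (by simp)

theorem Cardinal.mk_iUnion_le_of_le {ι α : Type u} {c : Cardinal.{u}} (hc : ℵ₀ ≤ c)
    (t : ι → Set α) (hι : #ι ≤ c) (ht : ∀ i, #(t i) ≤ c) : #(⋃ i, t i) ≤ c :=
  (mk_iUnion_le t).trans ((mul_le_mul' hι (ciSup_le' ht)).trans (mul_eq_self hc).le)

/-- If `θ` is regular and `2 ^ κ ≤ θ` for `κ < θ`, a set of size at most `θ` has at most `θ`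
subsets of size less than `θ`. -/
theorem Cardinal.IsRegular.mk_small_subsets_le {θ : Cardinal.{u}} (hθ : θ.IsRegular)
    (hpow : ∀ κ < θ, 2 ^ κ ≤ θ) {Y : Type u} (D : Set Y) (hD : #D ≤ θ) :
    #{s : Set Y | s ⊆ D ∧ #s < θ} ≤ θ := by
  have hDT : #D ≤ #θ.ord.ToType := by rwa [mk_ord_toType]
  obtain ⟨e⟩ := hDT
  let t : θ.ord.ToType → Set (Set Y) := fun a ↦ 𝒫 {y | ∃ h : y ∈ D, e ⟨y, h⟩ < a}
  have hsub : {s : Set Y | s ⊆ D ∧ #s < θ} ⊆ ⋃ a, t a := by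
    rintro s ⟨hsD, hs⟩
    obtain ⟨a, ha⟩ := hθ.exists_forall_lt (range fun y : s ↦ e ⟨y, hsD y.2⟩)
      (mk_range_le.trans_lt hs)
    exact mem_iUnion.2 ⟨a, fun y hy ↦ ⟨hsD hy, ha _ ⟨⟨y, hy⟩, rfl⟩⟩⟩
  refine (mk_le_mk_of_subset hsub).trans
    (mk_iUnion_le_of_le hθ.aleph0_le t (mk_ord_toType θ).le fun a ↦ ?_)
  rw [mk_powerset]
  refine hpow _ (lt_of_le_of_lt ?_ (mk_Iio_toType_lt a))
  refine mk_le_of_injective (f := fun y ↦ ⟨e ⟨y.1, y.2.1⟩, y.2.2⟩) fun x y hxy ↦ ?_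
  simpa [Subtype.ext_iff] using hxy

/-- If `θ` is regular and `2 ^ κ ≤ θ` for `κ < θ`, there is a set of size at most `θ` closed under
a given operation that sends sets of size `< θ` to sets of size `≤ θ`. -/
theorem Cardinal.IsRegular.exists_closed_set {θ : Cardinal.{u}} (hθ : θ.IsRegular)
    (hpow : ∀ κ < θ, 2 ^ κ ≤ θ) {Y : Type u} (g : Set Y → Set Y)
    (hg : ∀ s : Set Y, #s < θ → #(g s) ≤ θ) :
    ∃ D : Set Y, #D ≤ θ ∧ ∀ s ⊆ D, #s < θ → g s ⊆ D := by
  obtain ⟨D, hD⟩ : ∃ D : θ.ord.ToType → Set Y, ∀ a,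
      D a = ⋃ b : Iio a, ⋃ s : {s : Set Y | s ⊆ D b ∧ #s < θ}, g s := by
    let G : (a : θ.ord.ToType) → ((b : θ.ord.ToType) → b < a → Set Y) → Set Y :=
      fun a D ↦ ⋃ b : Iio a, ⋃ s : {s : Set Y | s ⊆ D b b.2 ∧ #s < θ}, g s
    exact ⟨wellFounded_lt.fix G, fun a ↦ wellFounded_lt.fix_eq G a⟩
  have hcard : ∀ a, #(D a) ≤ θ := fun a ↦ by
    induction a using WellFoundedLT.induction with
    | ind a ih =>
      rw [hD]
      refine mk_iUnion_le_of_le hθ.aleph0_le _ (mk_Iio_toType_lt a).le fun b ↦ ?_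
      exact mk_iUnion_le_of_le hθ.aleph0_le _ (hθ.mk_small_subsets_le hpow _ (ih b b.2))
        fun s ↦ hg s s.2.2
  have hstep : ∀ a b, b < a → ∀ s ⊆ D b, #s < θ → g s ⊆ D a := fun a b hba s hsb hs ↦ by
    rw [hD a]
    exact fun y hy ↦ mem_iUnion.2 ⟨⟨b, hba⟩, mem_iUnion.2 ⟨⟨s, hsb, hs⟩, hy⟩⟩
  have hmono : ∀ a b, b < a → D b ⊆ D a := fun a b hba ↦ by
    rw [hD b]
    exact iUnion_subset fun c ↦ iUnion_subset fun s ↦ hstep a c (c.2.trans hba) s s.2.1 s.2.2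
  refine ⟨⋃ a, D a, mk_iUnion_le_of_le hθ.aleph0_le _ (mk_ord_toType θ).le hcard,
    fun s hsD hs ↦ ?_⟩
  choose i hi using fun y : s ↦ mem_iUnion.1 (hsD y.2)
  obtain ⟨a, ha⟩ := hθ.exists_forall_lt (range i) (mk_range_le.trans_lt hs)
  obtain ⟨b, hb⟩ := hθ.exists_forall_lt {a} (by simpa using hθ.nat_lt 1)
  exact (hstep b a (hb a rfl) s (fun y hy ↦ hmono _ _ (ha _ ⟨⟨y, hy⟩, rfl⟩) (hi ⟨y, hy⟩)) hs).trans
    (subset_iUnion D b)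

/-- Chain condition: a family of sets of size `< θ`, any two distinct members `p`, `q` of which
conflict in the sense that `f` sends some element of `q` into `p`, has at most `θ` members. -/
theorem Cardinal.IsRegular.mk_le_of_pairwise_conflict {θ : Cardinal.{u}} (hθ : θ.IsRegular)
    (hpow : ∀ κ < θ, 2 ^ κ ≤ θ) {Y : Type u} (f : Y → Y) (A : Set (Set Y))
    (hsmall : ∀ p ∈ A, #p < θ)
    (hself : ∀ p ∈ A, ∀ y ∈ p, f y ∉ p)
    (hA : ∀ p ∈ A, ∀ q ∈ A, p ≠ q → ∃ y ∈ q, f y ∈ p) :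
    #A ≤ θ := by
  classical
  let compat : Set Y → Set Y → Prop := fun s q ↦ ∀ y ∈ q, f y ∉ s
  let pick : Set Y → Set Y := fun s ↦ if h : ∃ q ∈ A, compat s q then h.choose else ∅
  have hpick : ∀ s, (∃ q ∈ A, compat s q) → pick s ∈ A ∧ compat s (pick s) := fun s h ↦ by
    simp only [pick, dif_pos h]
    exact h.choose_spec
  have hpick_small : ∀ s : Set Y, #(pick s) < θ := fun s ↦ by
    by_cases h : ∃ q ∈ A, compat s q
    · exact hsmall _ (hpick s h).1
    · simpa [pick, dif_neg h] using hθ.pos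
  obtain ⟨D, hD, hclosed⟩ := hθ.exists_closed_set hpow (fun s ↦ pick s ∪ f '' pick s)
    fun s _ ↦ (mk_union_le _ _).trans
      (add_lt_of_lt hθ.aleph0_le (hpick_small s) (mk_image_le.trans_lt (hpick_small s))).le
  suffices h : ∀ p ∈ A, p ⊆ D from
    (mk_le_mk_of_subset (t := {s : Set Y | s ⊆ D ∧ #s < θ}) fun p hp ↦
      ⟨h p hp, hsmall p hp⟩).trans (hθ.mk_small_subsets_le hpow D hD)
  intro p hp
  have hs : #(p ∩ D : Set Y) < θ := (mk_le_mk_of_subset inter_subset_left).trans_lt (hsmall p hp)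
  have hsub := hclosed (p ∩ D) inter_subset_right hs
  obtain ⟨hqA, hq⟩ := hpick (p ∩ D) ⟨p, hp, fun y hy hfy ↦ hself p hp y hy hfy.1⟩
  by_contra hpD
  have hne : p ≠ pick (p ∩ D) := fun h ↦ hpD (h.subset.trans (subset_union_left.trans hsub))
  obtain ⟨y, hy, hfy⟩ := hA p hp _ hqA hne
  exact hq y hy ⟨hfy, hsub (Or.inr ⟨y, hy, rfl⟩)⟩

theorem Cardinal.IsRegular.two_power_le_of_gch
    (GCH : ∀ μ : Cardinal.{u}, ℵ₀ ≤ μ → 2 ^ μ = Order.succ μ)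
    {θ : Cardinal.{u}} (hθ : θ.IsRegular) (κ : Cardinal.{u}) (hκ : κ < θ) : 2 ^ κ ≤ θ := by
  rcases lt_or_ge κ ℵ₀ with h | h
  · exact (power_lt_aleph0 (natCast_lt_aleph0 (n := 2)) h).le.trans hθ.aleph0_le
  · rw [GCH κ h]
    exact Order.succ_le_of_lt hκ

theorem CohenPoset.mk_lt {κ lam : Cardinal.{0}} {p : Set ((κ.out × lam.out) × Bool)}
    (hp : p ∈ CohenPoset κ lam) : #p < κ := by
  refine lt_of_le_of_lt ?_ hp.2
  refine (mk_image_eq_of_injOn Prod.fst p ?_).ge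
  rintro ⟨a, b⟩ hx ⟨a', b'⟩ hy (rfl : a = a')
  rw [hp.1 a b b' hx hy]

theorem CohenPoset.union_mem {κ lam : Cardinal.{0}} (hκ : ℵ₀ ≤ κ)
    {p q : Set ((κ.out × lam.out) × Bool)} (hp : p ∈ CohenPoset κ lam) (hq : q ∈ CohenPoset κ lam)
    (hpq : ∀ a b, (a, b) ∈ q → (a, !b) ∉ p) : p ∪ q ∈ CohenPoset κ lam := by
  have key : ∀ a b₁ b₂, (a, b₁) ∈ p → (a, b₂) ∈ q → b₁ = b₂ := fun a b₁ b₂ h₁ h₂ ↦ by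
    by_contra hne
    exact hpq a b₂ h₂ (by rwa [← Bool.eq_not.2 hne])
  refine ⟨?_, ?_⟩
  · rintro a b₁ b₂ (h₁ | h₁) (h₂ | h₂)
    · exact hp.1 a b₁ b₂ h₁ h₂
    · exact key a b₁ b₂ h₁ h₂
    · exact (key a b₂ b₁ h₂ h₁).symm
    · exact hq.1 a b₁ b₂ h₁ h₂
  · rw [image_union]
    exact (mk_union_le _ _).trans_lt (add_lt_of_lt hκ hp.2 hq.2)

theorem EastonSupported.union_mem {C : Set Cardinal.{0}} (hC : ∀ κ ∈ C, κ.IsRegular)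
    {F : Cardinal.{0} → Cardinal.{0}} {S : Set Cardinal.{0}}
    {p q : (κ : Cardinal.{0}) → Set ((κ.out × (F κ).out) × Bool)}
    (hp : p ∈ EastonSupported C F S) (hq : q ∈ EastonSupported C F S)
    (hpq : ∀ κ a b, (a, b) ∈ q κ → (a, !b) ∉ p κ) :
    (fun κ ↦ p κ ∪ q κ) ∈ EastonSupported C F S := by
  obtain ⟨⟨hp₁, hp₂, hp₃⟩, hp₄⟩ := hp
  obtain ⟨⟨hq₁, hq₂, hq₃⟩, hq₄⟩ := hq
  have hne : ∀ κ, p κ ∪ q κ ≠ ∅ → p κ ≠ ∅ ∨ q κ ≠ ∅ := fun κ h ↦ by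
    simpa only [ne_eq, union_empty_iff, not_and_or] using h
  refine ⟨⟨fun κ hκ ↦ CohenPoset.union_mem (hC κ hκ).aleph0_le (hp₁ κ hκ) (hq₁ κ hκ) (hpq κ),
    fun κ hκ ↦ by simp [hp₂ κ hκ, hq₂ κ hκ], fun θ hθ ↦ ?_⟩,
    fun κ hκ ↦ (hne κ hκ).elim (hp₄ κ) (hq₄ κ)⟩
  have hsub : {κ | κ ∈ C ∧ p κ ∪ q κ ≠ ∅ ∧ κ < θ} ⊆
      {κ | κ ∈ C ∧ p κ ≠ ∅ ∧ κ < θ} ∪ {κ | κ ∈ C ∧ q κ ≠ ∅ ∧ κ < θ} := by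
    rintro κ ⟨hκC, hκ, hκθ⟩
    exact (hne κ hκ).imp (fun h ↦ ⟨hκC, h, hκθ⟩) fun h ↦ ⟨hκC, h, hκθ⟩
  exact (mk_le_mk_of_subset hsub).trans_lt <| (mk_union_le _ _).trans_lt <|
    add_lt_of_lt hθ.lift.aleph0_le (hp₃ θ hθ) (hq₃ θ hθ)

/-- A condition supported on cardinals `≤ θ`, with `θ` regular, has total size `< θ`. -/
theorem EastonSupported.mk_lt {C : Set Cardinal.{0}} {F : Cardinal.{0} → Cardinal.{0}}
    {θ : Cardinal.{0}} (hθ : θ.IsRegular)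
    {p : (κ : Cardinal.{0}) → Set ((κ.out × (F κ).out) × Bool)}
    (hp : p ∈ EastonSupported C F {κ | κ ≤ θ}) :
    #{y : Σ κ : Cardinal.{0}, (κ.out × (F κ).out) × Bool | y.2 ∈ p y.1} < lift.{1} θ := by
  obtain ⟨⟨hp₁, hp₂, hp₃⟩, hp₄⟩ := hp
  let t : (κ : Cardinal.{0}) → Set (Σ κ : Cardinal.{0}, (κ.out × (F κ).out) × Bool) :=
    fun κ ↦ Sigma.mk κ '' p κ
  have ht : ∀ κ ≤ θ, #(t κ) < lift.{1} θ := fun κ hκθ ↦ by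
    have hlt : #(p κ) < θ := by
      by_cases hκ : κ ∈ C
      · exact (CohenPoset.mk_lt (hp₁ κ hκ)).trans_le hκθ
      · simpa [hp₂ κ hκ] using hθ.pos
    have hle : lift.{0} #(t κ) ≤ lift.{1} #(p κ) := mk_image_le_lift
    rw [lift_id'.{0, 1}] at hle
    exact hle.trans_lt (lift_lt.2 hlt)
  have hsub : {y : Σ κ : Cardinal.{0}, (κ.out × (F κ).out) × Bool | y.2 ∈ p y.1} ⊆
      t θ ∪ ⋃ κ : {κ : Cardinal.{0} // κ ∈ C ∧ p κ ≠ ∅ ∧ κ < θ}, t κ := by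
    rintro ⟨κ, y⟩ (hy : y ∈ p κ)
    have hne : p κ ≠ ∅ := (nonempty_of_mem hy).ne_empty
    have hmem : (⟨κ, y⟩ : Σ κ : Cardinal.{0}, (κ.out × (F κ).out) × Bool) ∈ t κ := ⟨y, hy, rfl⟩
    have hκθ : κ ≤ θ := hp₄ κ hne
    rcases hκθ.eq_or_lt with rfl | hlt
    · exact Or.inl hmem
    · exact Or.inr (mem_iUnion.2 ⟨⟨κ, by_contra fun h ↦ hne (hp₂ κ h), hne, hlt⟩, hmem⟩)
  refine (mk_le_mk_of_subset hsub).trans_lt <| (mk_union_le _ _).trans_lt <|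
    add_lt_of_lt hθ.lift.aleph0_le (ht θ le_rfl) ?_
  exact (card_iUnion_lt_iff_forall_of_isRegular hθ.lift (hp₃ θ hθ)).2 fun κ ↦ ht κ κ.2.2.2.le

/-- Assume GCH. Then `ℙ^{≤θ}`, the sub-poset of the Easton product of conditions
supported on `C ∩ (θ+1)` (coordinates `κ ≤ θ`), satisfies the `θ⁺`-chain condition for
every regular infinite `θ`: every set of pairwise incompatible conditions in `ℙ^{≤θ}`
has cardinality at most `θ`. -/
theorem easton_lower_part_cc
    (GCH : ∀ μ : Cardinal.{0}, ℵ₀ ≤ μ → 2 ^ μ = Order.succ μ)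
    (C : Set Cardinal.{0}) (hC : ∀ κ ∈ C, κ.IsRegular)
    (F : Cardinal.{0} → Cardinal.{0}) (θ : Cardinal) (hθ : θ.IsRegular)
    (A : Set ((κ : Cardinal.{0}) → Set ((κ.out × (F κ).out) × Bool)))
    (hA : A ⊆ EastonSupported C F {κ | κ ≤ θ})
    (hinc : ∀ p ∈ A, ∀ q ∈ A, p ≠ q →
      ¬∃ r ∈ EastonSupported C F {κ | κ ≤ θ}, (∀ κ, p κ ⊆ r κ) ∧ (∀ κ, q κ ⊆ r κ)) :
    #A ≤ Cardinal.lift.{1} θ := by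
  let Y := Σ κ : Cardinal.{0}, (κ.out × (F κ).out) × Bool
  let code : ((κ : Cardinal.{0}) → Set ((κ.out × (F κ).out) × Bool)) → Set Y :=
    fun p ↦ {y | y.2 ∈ p y.1}
  have hcode : Function.Injective code := fun p q h ↦ by
    funext κ
    ext y
    exact Set.ext_iff.1 h ⟨κ, y⟩
  have hpow : ∀ κ < lift.{1} θ, 2 ^ κ ≤ lift.{1} θ := fun κ hκ ↦ by
    obtain ⟨μ, hμ, rfl⟩ := lt_lift_iff.1 hκ
    rw [← lift_two_power, lift_le]
    exact hθ.two_power_le_of_gch GCH μ hμ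
  rw [← mk_image_eq hcode (s := A)]
  refine hθ.lift.mk_le_of_pairwise_conflict hpow (fun y : Y ↦ ⟨y.1, y.2.1, !y.2.2⟩) _ ?_ ?_ ?_
  · rintro _ ⟨p, hp, rfl⟩
    exact EastonSupported.mk_lt hθ (hA hp)
  · rintro _ ⟨p, hp, rfl⟩ ⟨κ, a, b⟩ (hy : (a, b) ∈ p κ) (hy' : (a, !b) ∈ p κ)
    have hκ : κ ∈ C := by_contra fun h ↦ by simp [(hA hp).1.2.1 κ h] at hy
    simpa using ((hA hp).1.1 κ hκ).1 a _ _ hy hy'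
  · rintro _ ⟨p, hp, rfl⟩ _ ⟨q, hq, rfl⟩ hne
    by_contra! hcon
    exact hinc p hp q hq (fun h ↦ hne (h ▸ rfl)) ⟨_,
      EastonSupported.union_mem hC (hA hp) (hA hq) fun κ a b h ↦ hcon ⟨κ, a, b⟩ h,
      fun _ ↦ subset_union_left, fun _ ↦ subset_union_right⟩
end

section
/- Let κ be an infinite cardinal satisfying κ = 2^{<κ}, i.e., κ equals the supremum of 2^μ over infinite cardinals μ < κ. Then there exists a universal simple graph on vertex set κ: a simple graph on κ into which every simple graph on κ admits a graph embedding. -/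
open Cardinal

/-- The graph on pairs `(a, A)` with `A` a set of elements below `a`, in which
`(a, A)` and `(b, B)` with `a < b` are adjacent if and only if `a ∈ B`. -/
def initialSegmentGraph (V : Type*) [LinearOrder V] :
    SimpleGraph (Σ a : V, Set (Set.Iio a)) where
  Adj x y := (∃ h : x.1 < y.1, ⟨x.1, h⟩ ∈ y.2) ∨ ∃ h : y.1 < x.1, ⟨y.1, h⟩ ∈ x.2
  symm := ⟨fun _ _ h => h.symm⟩
  loopless := ⟨fun _ h => h.elim (fun h => h.1.false) (fun h => h.1.false)⟩

/-- Every graph on a linear order embeds in `initialSegmentGraph`, by sending each vertex to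
itself together with its set of smaller neighbours. -/
def embeddingInitialSegmentGraph {V : Type*} [LinearOrder V] (G : SimpleGraph V) :
    G ↪g initialSegmentGraph V where
  toFun b := ⟨b, {a | G.Adj a b}⟩
  inj' _ _ h := congrArg Sigma.fst h
  map_rel_iff' {a b} := by
    change ((∃ _ : a < b, G.Adj a b) ∨ ∃ _ : b < a, G.Adj b a) ↔ G.Adj a b
    constructor
    · rintro (⟨_, h⟩ | ⟨_, h⟩)
      exacts [h, h.symm]
    · intro h
      exact h.ne.lt_or_gt.imp (fun hlt => ⟨hlt, h⟩) fun hlt => ⟨hlt, h.symm⟩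

/-- If `κ = 2 ^< κ`, there are at most `κ` pairs of an `a` in the well-order `κ` and a set of
elements below `a`. -/
theorem mk_sigma_set_Iio_le (κ : Cardinal) (hκ : ℵ₀ ≤ κ) (h : κ = 2 ^< κ) :
    #(Σ a : κ.ord.ToType, Set (Set.Iio a)) ≤ κ := by
  rw [mk_sigma]
  calc
    Cardinal.sum (fun a : κ.ord.ToType => #(Set (Set.Iio a))) ≤
        Cardinal.sum fun _ : κ.ord.ToType => κ := by
      refine Cardinal.sum_le_sum _ _ fun a => ?_
      rw [mk_set]
      exact (le_powerlt 2 (mk_Iio_toType_ord_lt a)).trans_eq h.symm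
    _ = κ := by rw [sum_const', mk_ord_toType, mul_eq_self hκ]

/-- If `κ` is an infinite cardinal with `κ = 2^{<κ}` (the supremum of `2^μ` over the
cardinals `μ < κ`), then there is a universal simple graph on a vertex set of size `κ`:
one into which every simple graph on `κ` vertices embeds as an induced subgraph. -/
theorem exists_universal_graph_of_powerlt (κ : Cardinal) (hκ : ℵ₀ ≤ κ)
    (h : κ = 2 ^< κ) :
    ∃ H : SimpleGraph κ.out, ∀ G : SimpleGraph κ.out, Nonempty (G ↪g H) := by
  obtain ⟨e⟩ : Nonempty (κ.out ≃ κ.ord.ToType) := by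
    rw [← Cardinal.eq, mk_out, mk_ord_toType]
  obtain ⟨f⟩ : Nonempty ((Σ a : κ.ord.ToType, Set (Set.Iio a)) ↪ κ.out) := by
    rw [← Cardinal.le_def, mk_out]
    exact mk_sigma_set_Iio_le κ hκ h
  refine ⟨(initialSegmentGraph κ.ord.ToType).map f, fun G => ⟨?_⟩⟩
  exact (SimpleGraph.Embedding.map f _).comp
    ((embeddingInitialSegmentGraph _).comp (SimpleGraph.Embedding.map e.toEmbedding G))
end

section
/- Let κ be a singular cardinal of cofinality ω. Then the universality number of bounded κ-Trees under reduction is exactly κ⁺: there exists a family of κ⁺ many bounded κ-Trees such that every bounded κ-Tree admits a reduction into some member of the family, and no family of at most κ many bounded κ-Trees has this property. -/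
open Cardinal

/-- A `κ`-Tree: a partially ordered set of cardinality `κ` with a least element (root),
in which the set of strict predecessors of every element is well-ordered, and whose
height — the supremum over all elements of the order types of their sets of strict
predecessors — equals `κ` (that is, the ordinal `κ.ord`). -/
structure KappaTree (κ : Cardinal.{0}) where
  carrier : Type
  str : PartialOrder carrier
  card_eq : #carrier = κ
  root : carrier
  root_le : ∀ x, str.le root x
  predWellOrder : ∀ x : carrier,
    IsWellOrder {y : carrier // str.lt y x} (fun a b => str.lt a.1 b.1)
  height_eq :
    (⨆ x : carrier,
      @Ordinal.type {y : carrier // str.lt y x} (fun a b => str.lt a.1 b.1)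
        (predWellOrder x)) = κ.ord

/-- A `κ`-Tree is bounded if it has no chain of order type `κ` (no `κ`-branch). -/
def KappaTree.Bounded {κ : Cardinal.{0}} (T : KappaTree κ) : Prop :=
  ¬∃ f : {o : Ordinal // o < κ.ord} → T.carrier,
    ∀ a b, a.1 < b.1 → T.str.lt (f a) (f b)

/-- A reduction from `T` to `T'` is a strict-order-preserving map. -/
def KappaTree.Reduction {κ : Cardinal.{0}} (T T' : KappaTree κ) : Prop :=
  ∃ f : T.carrier → T'.carrier, ∀ x y, T.str.lt x y → T'.str.lt (f x) (f y)

/-- The rank of a point in a well-founded partial order. -/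
noncomputable abbrev height {P : Type} [PartialOrder P] [WellFoundedLT P] (x : P) : Ordinal.{0} :=
  IsWellFounded.rank (α := P) (· < ·) x

/-- Any two points with a common upper bound are comparable. -/
def IsForest (P : Type) [PartialOrder P] : Prop :=
  ∀ ⦃a b x : P⦄, a ≤ x → b ≤ x → a ≤ b ∨ b ≤ a

section Forest

variable {P : Type} [PartialOrder P] [WellFoundedLT P]

theorem height_lt_height {x y : P} (h : x < y) : height x < height y :=
  IsWellFounded.rank_lt_of_rel h

theorem exists_le_height_eq (x : P) {o : Ordinal.{0}} (h : o ≤ height x) :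
    ∃ y ≤ x, height y = o := by
  induction x using WellFoundedLT.induction with
  | ind x ih =>
    rcases h.eq_or_lt with rfl | h
    · exact ⟨x, le_rfl, rfl⟩
    · rw [height, IsWellFounded.rank_eq, Ordinal.lt_iSup_iff] at h
      obtain ⟨⟨b, hb⟩, ho⟩ := h
      obtain ⟨y, hy, rfl⟩ := ih b hb (Order.lt_succ_iff.1 ho)
      exact ⟨y, hy.trans hb.le, rfl⟩

theorem IsForest.eq_of_height_eq (hP : IsForest P) {a b x : P} (ha : a ≤ x) (hb : b ≤ x)
    (h : height a = height b) : a = b := by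
  rcases hP ha hb with hab | hab
  · exact hab.eq_of_not_lt fun hlt => (height_lt_height hlt).ne h
  · exact (hab.eq_of_not_lt fun hlt => (height_lt_height hlt).ne h.symm).symm

theorem IsForest.lt_of_height_lt (hP : IsForest P) {a b x : P} (ha : a ≤ x) (hb : b ≤ x)
    (h : height a < height b) : a < b := by
  rcases hP ha hb with hab | hab
  · exact hab.lt_of_ne fun e => h.ne (congrArg _ e)
  · rcases hab.eq_or_lt with rfl | hlt
    · exact absurd h (lt_irrefl _)
    · exact absurd h (height_lt_height hlt).not_gt

/-- The downward closure of a chain of unbounded height below `o` contains a chain of type `o`. -/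
theorem IsForest.exists_branch (hP : IsForest P) {o : Ordinal.{0}} {C : Set P}
    (hC : IsChain (· ≤ ·) C) (h : ∀ a < o, ∃ x ∈ C, a ≤ height x) :
    ∃ f : {a : Ordinal.{0} // a < o} → P, ∀ a b, a.1 < b.1 → f a < f b := by
  have h' : ∀ a : {a : Ordinal.{0} // a < o}, ∃ y, ∃ x ∈ C, y ≤ x ∧ height y = a.1 := by
    rintro ⟨a, ha⟩
    obtain ⟨x, hx, hax⟩ := h a ha
    obtain ⟨y, hy, hya⟩ := exists_le_height_eq x hax
    exact ⟨y, x, hx, hy, hya⟩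
  choose f hf using h'
  refine ⟨f, fun a b hab => ?_⟩
  obtain ⟨x, hx, hax, ha⟩ := hf a
  obtain ⟨y, hy, hby, hb⟩ := hf b
  have hlt : height (f a) < height (f b) := by rwa [ha, hb]
  rcases hC.total hx hy with hxy | hxy
  · exact hP.lt_of_height_lt (hax.trans hxy) hby hlt
  · exact hP.lt_of_height_lt hax (hby.trans hxy) hlt

/-- A step from `p` to `q` moves up the order and increases the index `n`, reaching height at
least `c n`. -/
def Climbs (c : ℕ → Ordinal.{0}) (q p : P × ℕ) : Prop :=
  p.2 < q.2 ∧ p.1 < q.1 ∧ c q.2 ≤ height q.1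

theorem IsForest.wellFounded_climbs (hP : IsForest P) {o : Ordinal.{0}}
    (hbdd : ¬∃ f : {a : Ordinal.{0} // a < o} → P, ∀ a b, a.1 < b.1 → f a < f b)
    {c : ℕ → Ordinal.{0}} (hc : Monotone c) (hco : ∀ a < o, ∃ n, a ≤ c n) :
    IsWellFounded (P × ℕ) (Climbs c) := by
  refine ⟨wellFounded_iff_isEmpty_descending_chain.2 ⟨fun ⟨g, hg⟩ => hbdd ?_⟩⟩
  have hmono : StrictMono fun n => (g n).1 := strictMono_nat_of_lt_succ fun n => (hg n).2.1
  have hidx : StrictMono fun n => (g n).2 := strictMono_nat_of_lt_succ fun n => (hg n).1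
  refine hP.exists_branch hmono.monotone.isChain_range fun a ha => ?_
  obtain ⟨n, hn⟩ := hco a ha
  refine ⟨_, ⟨n + 1, rfl⟩, hn.trans ((hc ?_).trans (hg n).2.2)⟩
  exact (Nat.le_succ n).trans (hidx.le_apply (x := n + 1))

end Forest

theorem rank_lt_ord_succ {α : Type} (r : α → α → Prop) [IsWellFounded α r] {κ : Cardinal.{0}}
    (hα : #α ≤ κ) (a : α) : IsWellFounded.rank r a < (Order.succ κ).ord := by
  rw [Cardinal.lt_ord, Order.lt_succ_iff]
  refine le_trans ?_ hα
  have hsub : Set.Iio (IsWellFounded.rank r a) ⊆ Set.range (IsWellFounded.rank r) :=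
    fun o ho => IsWellFounded.mem_range_rank_of_le (le_of_lt ho)
  have h := Cardinal.mk_le_mk_of_subset hsub
  have h2 := Cardinal.mk_range_le_lift (f := IsWellFounded.rank r)
  rw [Cardinal.mk_Iio_ordinal] at h
  have h3 : Cardinal.lift.{1} (IsWellFounded.rank r a).card ≤ Cardinal.lift.{1} #α := by
    simpa using (Cardinal.lift_le.2 h).trans h2
  exact Cardinal.lift_le.1 h3

/-- A strictly increasing cofinal sequence, starting above the bottom. -/
structure IsLadder {K : Type} [LinearOrder K] (c : ℕ → K) : Prop where
  strictMono : StrictMono c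
  exists_lt : ∀ x, ∃ n, x < c n
  not_isMin : ∀ n, ∃ x, x < c n

theorem exists_isLadder {K : Type} [LinearOrder K] [NoMaxOrder K] [Nonempty K]
    (h : Order.cof K ≤ ℵ₀) : ∃ c : ℕ → K, IsLadder c := by
  obtain ⟨s, hs, hsc⟩ := Order.exists_cof_eq (α := K)
  have hcount : s.Countable := by
    rw [← Cardinal.le_aleph0_iff_set_countable, hsc]; exact h
  obtain ⟨x₀⟩ := ‹Nonempty K›
  obtain ⟨y₀, hy₀, -⟩ := hs x₀
  obtain ⟨e, rfl⟩ := hcount.exists_eq_range ⟨y₀, hy₀⟩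
  have hstep : ∀ (n : ℕ) (x : K), ∃ y, x < y ∧ e n < y := fun n x => by
    obtain ⟨y, hy⟩ := exists_gt (max x (e n))
    exact ⟨y, (le_max_left _ _).trans_lt hy, (le_max_right _ _).trans_lt hy⟩
  choose g hg hg' using hstep
  let c : ℕ → K := fun n => Nat.rec (g 0 x₀) (fun n x => g n x) n
  have hc : StrictMono c := strictMono_nat_of_lt_succ fun n => hg n (c n)
  refine ⟨c, hc, fun x => ?_, fun n => ⟨x₀, (hg 0 x₀).trans_le (hc.monotone n.zero_le)⟩⟩
  obtain ⟨_, ⟨n, rfl⟩, hn⟩ := hs x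
  exact ⟨n + 1, hn.trans_lt (hg' n (c n))⟩

theorem IsLadder.exists_index {K : Type} [LinearOrder K] {c : ℕ → K} (hc : IsLadder c) (x : K) :
    ∃ n, ∀ i, c i ≤ x ↔ i < n := by
  classical
  refine ⟨Nat.find (hc.exists_lt x), fun i => ⟨fun h => ?_, fun h => ?_⟩⟩
  · rw [Nat.lt_find_iff]
    exact fun m hm => not_lt.2 ((hc.strictMono.monotone hm).trans h)
  · exact not_lt.1 (Nat.find_min (hc.exists_lt x) h)

/-- Pairs of a level `x` in `K` and a strictly decreasing list in `A`, with one entry for each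
rung of the ladder `c` that is at most `x`. -/
def DescNode {K : Type} [LinearOrder K] (c : ℕ → K) (A : Type) [LinearOrder A] : Type :=
  {p : K × List A // p.2.Pairwise (· > ·) ∧ ∀ i, c i ≤ p.1 ↔ i < p.2.length}

namespace DescNode

variable {K A : Type} [LinearOrder K] [LinearOrder A] {c : ℕ → K}

/-- The level of a node. -/
def level (p : DescNode c A) : K := p.1.1

/-- The decreasing list of a node. -/
def entries (p : DescNode c A) : List A := p.1.2

theorem pairwise (p : DescNode c A) : p.entries.Pairwise (· > ·) := p.2.1

theorem le_level_iff (p : DescNode c A) {i : ℕ} : c i ≤ p.level ↔ i < p.entries.length := p.2.2 i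

theorem ext' {p q : DescNode c A} (h₁ : p.level = q.level) (h₂ : p.entries = q.entries) : p = q :=
  Subtype.ext (Prod.ext h₁ h₂)

theorem length_le {p q : DescNode c A} (h : p.level ≤ q.level) :
    p.entries.length ≤ q.entries.length := by
  by_contra! hlt
  exact lt_irrefl _ (q.le_level_iff.1 ((p.le_level_iff.2 hlt).trans h))

instance : PartialOrder (DescNode c A) where
  le p q := p.level ≤ q.level ∧ p.entries <+: q.entries
  le_refl p := ⟨le_rfl, List.prefix_rfl⟩
  le_trans p q r h₁ h₂ := ⟨h₁.1.trans h₂.1, h₁.2.trans h₂.2⟩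
  le_antisymm p q h₁ h₂ := ext' (h₁.1.antisymm h₂.1)
    (h₁.2.eq_of_length_le h₂.2.length_le)

theorem eq_of_prefix {p q : DescNode c A} (h₁ : p.level = q.level)
    (h₂ : p.entries <+: q.entries) : p = q :=
  ext' h₁ (h₂.eq_of_length_le (length_le h₁.ge))

theorem lt_iff {p q : DescNode c A} :
    p < q ↔ p.level < q.level ∧ p.entries <+: q.entries := by
  constructor
  · intro h
    exact ⟨h.le.1.lt_of_ne fun e => h.ne (eq_of_prefix e h.le.2), h.le.2⟩
  · rintro ⟨h₁, h₂⟩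
    exact lt_of_le_of_ne ⟨h₁.le, h₂⟩ fun e => h₁.ne (congrArg level e)

theorem level_strictMono : StrictMono (level : DescNode c A → K) := fun _ _ h => (lt_iff.1 h).1

theorem le_of_level_le {p q r : DescNode c A} (hp : p ≤ r) (hq : q ≤ r) (h : p.level ≤ q.level) :
    p ≤ q :=
  ⟨h, List.prefix_of_prefix_length_le hp.2 hq.2 (length_le h)⟩

theorem isForest : IsForest (DescNode c A) := fun a b _ ha hb =>
  (le_total a.level b.level).imp (le_of_level_le ha hb) (le_of_level_le hb ha)

theorem exists_lt_level_eq (hc : IsLadder c) (p : DescNode c A) {x : K} (hx : x < p.level) :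
    ∃ q < p, q.level = x := by
  obtain ⟨n, hn⟩ := hc.exists_index x
  have hnp : n ≤ p.entries.length := by
    by_contra! hlt
    exact lt_irrefl _ (p.le_level_iff.1 (((hn _).2 hlt).trans hx.le))
  refine ⟨⟨(x, p.entries.take n), p.pairwise.sublist (List.take_sublist _ _), fun i => ?_⟩,
    lt_iff.2 ⟨hx, List.take_prefix _ _⟩, rfl⟩
  simpa [hnp] using hn i

theorem exists_level_eq (hc : IsLadder c) [Infinite A] (x : K) :
    ∃ p : DescNode c A, p.level = x := by
  obtain ⟨n, hn⟩ := hc.exists_index x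
  obtain ⟨s, hs⟩ := Infinite.exists_subset_card_eq A n
  refine ⟨⟨(x, s.sort (· ≥ ·)), s.sortedGT_sort.pairwise, fun i => ?_⟩, rfl⟩
  simpa [hs] using hn i

theorem exists_root (hc : IsLadder c) [OrderBot K] : ∃ p : DescNode c A, ∀ q, p ≤ q := by
  refine ⟨⟨(⊥, []), List.Pairwise.nil, fun i => ?_⟩, fun q => ⟨bot_le, List.nil_prefix⟩⟩
  obtain ⟨x, hx⟩ := hc.not_isMin i
  simpa using ne_bot_of_gt hx

theorem mk_eq [OrderBot K] (hc : IsLadder c) [Infinite A] {κ : Cardinal.{0}} (hκ : ℵ₀ ≤ κ)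
    (hK : #K = κ) (hA : #A ≤ κ) : #(DescNode c A) = κ := by
  apply le_antisymm
  · calc #(DescNode c A) ≤ #(K × List A) := Cardinal.mk_subtype_le _
      _ = #K * #(List A) := by simp
      _ ≤ κ * κ := by
        rw [Cardinal.mk_list_eq_mk, hK]
        gcongr
      _ = κ := Cardinal.mul_eq_self hκ
  · rw [← hK]
    exact Cardinal.mk_le_of_surjective (f := level) (exists_level_eq hc)

instance [WellFoundedLT K] : WellFoundedLT (DescNode c A) := level_strictMono.wellFoundedLT

instance isWellOrder_Iio [WellFoundedLT K] (p : DescNode c A) :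
    IsWellOrder {q // q < p} (fun a b => a.1 < b.1) where
  toTrichotomous := ⟨fun a b h₁ h₂ => Subtype.ext <| by
    rcases isForest a.2.le b.2.le with h | h
    · exact h.eq_of_not_lt h₁
    · exact (h.eq_of_not_lt h₂).symm⟩
  wf := InvImage.wf Subtype.val wellFounded_lt

theorem type_Iio_eq [WellFoundedLT K] (hc : IsLadder c) (p : DescNode c A) :
    Ordinal.type (fun a b : {q // q < p} => a.1 < b.1) = Ordinal.typein LT.lt p.level := by
  have hinj : ∀ {a b : {q // q < p}}, a.1.level ≤ b.1.level → a.1 ≤ b.1 :=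
    fun {a b} h => le_of_level_le a.2.le b.2.le h
  let g : {q // q < p} → Set.Iio p.level := fun q => ⟨q.1.level, level_strictMono q.2⟩
  have hg : Function.Bijective g := by
    refine ⟨fun a b h => ?_, fun ⟨x, hx⟩ => ?_⟩
    · have h' : a.1.level = b.1.level := congrArg Subtype.val h
      exact Subtype.ext ((hinj h'.le).antisymm (hinj h'.ge))
    · obtain ⟨q, hq, rfl⟩ := exists_lt_level_eq hc p hx
      exact ⟨⟨q, hq⟩, rfl⟩
  rw [← Ordinal.type_Iio_lt]
  refine Ordinal.type_eq.2 ⟨⟨Equiv.ofBijective g hg, fun {a b} => ?_⟩⟩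
  refine ⟨fun h => ?_, fun h => level_strictMono h⟩
  have h' : a.1.level < b.1.level := h
  exact (hinj h'.le).lt_of_ne fun e => h'.ne (congrArg level e)

theorem not_exists_branch [WellFoundedLT A] (hc : IsLadder c) :
    ¬∃ f : K → DescNode c A, StrictMono f ∧ ∀ x, x ≤ (f x).level := by
  rintro ⟨f, hf, hlev⟩
  have hlen : ∀ n, n < (f (c n)).entries.length := fun n => (le_level_iff _).1 (hlev _)
  refine (wellFounded_iff_isEmpty_descending_chain.1 (wellFounded_lt (α := A))).false
    ⟨fun n => (f (c n)).entries[n]'(hlen n), fun n => ?_⟩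
  have hpre := (hf (hc.strictMono n.lt_succ_self)).le.2
  change (f (c (n + 1))).entries[n + 1]'(hlen (n + 1)) < (f (c n)).entries[n]'(hlen n)
  rw [hpre.getElem (hlen n)]
  exact List.pairwise_iff_getElem.1 (pairwise _) n (n + 1) _ _ n.lt_succ_self

variable [WellFoundedLT K] {P : Type} [PartialOrder P] [WellFoundedLT P]

theorem typein_level_le_height (hc : IsLadder c) {f : DescNode c A → P} (hf : StrictMono f)
    (p : DescNode c A) : Ordinal.typein LT.lt p.level ≤ height (f p) := by
  induction p using WellFoundedLT.induction with
  | ind p ih =>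
    refine le_of_forall_lt fun o ho => ?_
    obtain ⟨x, rfl⟩ := Ordinal.typein_surj LT.lt (ho.trans (Ordinal.typein_lt_type _ _))
    obtain ⟨q, hq, rfl⟩ := exists_lt_level_eq hc p ((Ordinal.typein_lt_typein _).1 ho)
    exact (ih q hq).trans_lt (height_lt_height (hf hq))

/-- A strictly monotone map out of the tree of decreasing lists forces climbing ranks to be
large. -/
theorem typein_le_rank_climbs [WellFoundedLT A] (hc : IsLadder c) {f : DescNode c A → P}
    (hf : StrictMono f)
    [IsWellFounded (P × ℕ) (Climbs fun n => Ordinal.typein LT.lt (c n))]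
    (a : A) : ∀ (l : List A) (p : DescNode c A), p.level = c l.length → p.entries = l ++ [a] →
    Ordinal.typein LT.lt a ≤
      IsWellFounded.rank (Climbs fun n => Ordinal.typein LT.lt (c n)) (f p, l.length) := by
  induction a using WellFoundedLT.induction with
  | ind a ih =>
    intro l p hp hpl
    refine le_of_forall_lt fun o ho => ?_
    obtain ⟨b, rfl⟩ := Ordinal.typein_surj LT.lt (ho.trans (Ordinal.typein_lt_type _ _))
    have hb : b < a := (Ordinal.typein_lt_typein _).1 ho
    have hpw := p.pairwise
    rw [hpl] at hpw
    let q : DescNode c A := ⟨(c (l ++ [a]).length, l ++ [a] ++ [b]), by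
      refine List.pairwise_append.2 ⟨hpw, List.pairwise_singleton _ _, fun x hx y hy => ?_⟩
      rw [List.mem_singleton] at hy
      subst hy
      rcases List.mem_append.1 hx with hx | hx
      · exact hb.trans ((List.pairwise_append.1 hpw).2.2 x hx a (by simp))
      · rw [List.mem_singleton] at hx
        exact hx ▸ hb, fun i => by
      rw [hc.strictMono.le_iff_le]
      simp [Nat.lt_succ_iff]⟩
    have hpq : p < q := lt_iff.2 ⟨by
      rw [hp]
      exact hc.strictMono (by simp), by
      rw [hpl]
      exact List.prefix_append _ _⟩
    refine (ih b hb (l ++ [a]) q rfl rfl).trans_lt (IsWellFounded.rank_lt_of_rel ⟨?_, hf hpq, ?_⟩)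
    · simp
    · exact typein_level_le_height hc hf q

/-- A forest whose climbing relation is ranked in `A` maps into the tree of decreasing lists. -/
theorem exists_strictMono (hc : IsLadder c) (hP : IsForest P)
    (hK : ∀ x : P, height x < Ordinal.type (α := K) LT.lt) (ρ : P × ℕ → A)
    (hρ : ∀ q p, Climbs (fun n => Ordinal.typein LT.lt (c n)) q p → ρ q < ρ p) :
    ∃ f : P → DescNode c A, StrictMono f := by
  classical
  choose N hN using hc.exists_index
  choose lev hlev using fun x => Ordinal.typein_surj LT.lt (hK x)
  have hproj : ∀ (x : P) (i : ℕ), ∃ y, i < N (lev x) →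
      y ≤ x ∧ height y = Ordinal.typein LT.lt (c i) := fun x i => by
    by_cases hi : i < N (lev x)
    · have : Ordinal.typein LT.lt (c i) ≤ height x := by
        rw [← hlev x, Ordinal.typein_le_typein, not_lt]
        exact (hN _ _).2 hi
      obtain ⟨y, hy⟩ := exists_le_height_eq x this
      exact ⟨y, fun _ => hy⟩
    · exact ⟨x, fun h => absurd h hi⟩
  choose proj hproj using hproj
  refine ⟨fun x => ⟨(lev x, (List.range (N (lev x))).map fun i => ρ (proj x i, i)), ?_,
    fun i => by simpa using hN (lev x) i⟩, fun x y hxy => lt_iff.2 ⟨?_, ?_⟩⟩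
  · rw [List.pairwise_map]
    refine List.pairwise_lt_range.imp_of_mem fun {i j} hi hj hij => ?_
    obtain ⟨hi₁, hi₂⟩ := hproj x i (List.mem_range.1 hi)
    obtain ⟨hj₁, hj₂⟩ := hproj x j (List.mem_range.1 hj)
    refine hρ _ _ ⟨hij, hP.lt_of_height_lt hi₁ hj₁ ?_, hj₂.ge⟩
    rw [hi₂, hj₂]
    exact (Ordinal.typein_lt_typein _).2 (hc.strictMono hij)
  · rw [← Ordinal.typein_lt_typein (α := K) LT.lt]
    change Ordinal.typein LT.lt (lev x) < Ordinal.typein LT.lt (lev y)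
    rw [hlev, hlev]
    exact height_lt_height hxy
  · have hle : N (lev x) ≤ N (lev y) := by
      by_contra! hlt
      have hxy' : lev x < lev y := by
        rw [← Ordinal.typein_lt_typein (α := K) LT.lt, hlev, hlev]
        exact height_lt_height hxy
      exact lt_irrefl _ ((hN _ _).1 (((hN _ _).2 hlt).trans hxy'.le))
    have hmap : ((List.range (N (lev x))).map fun i => ρ (proj x i, i)) =
        (List.range (N (lev x))).map fun i => ρ (proj y i, i) := by
      refine List.map_congr_left fun i hi => ?_
      rw [List.mem_range] at hi
      obtain ⟨hx₁, hx₂⟩ := hproj x i hi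
      obtain ⟨hy₁, hy₂⟩ := hproj y i (hi.trans_le hle)
      rw [hP.eq_of_height_eq (hx₁.trans hxy.le) hy₁ (hx₂.trans hy₂.symm)]
    change List.map _ _ <+: List.map _ _
    rw [hmap]
    refine List.IsPrefix.map _ ?_
    rw [← Nat.min_eq_left hle, ← List.take_range]
    exact List.take_prefix _ _

end DescNode

instance KappaTree.instPartialOrder {κ : Cardinal.{0}} (T : KappaTree κ) :
    PartialOrder T.carrier := T.str

namespace KappaTree

variable {κ : Cardinal.{0}}

theorem isForest (T : KappaTree κ) : IsForest T.carrier := by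
  intro a b x ha hb
  rcases ha.eq_or_lt with rfl | ha
  · exact Or.inr hb
  rcases hb.eq_or_lt with rfl | hb
  · exact Or.inl ha.le
  have := T.predWellOrder x
  rcases trichotomous_of (fun a b : {y : T.carrier // T.str.lt y x} => T.str.lt a.1 b.1)
    ⟨a, ha⟩ ⟨b, hb⟩ with h | h | h
  · exact Or.inl (le_of_lt h)
  · exact Or.inl (congrArg Subtype.val h).le
  · exact Or.inr (le_of_lt h)

instance (T : KappaTree κ) : WellFoundedLT T.carrier := by
  refine ⟨⟨fun x => ⟨x, fun y hy => ?_⟩⟩⟩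
  have key : ∀ z : {y : T.carrier // T.str.lt y x}, Acc (· < ·) z.1 := by
    intro z
    induction z using (T.predWellOrder x).wf.induction with
    | h z ih => exact ⟨z.1, fun w hw => ih ⟨w, lt_trans hw z.2⟩ hw⟩
  exact key ⟨y, hy⟩

theorem Bounded.height_lt {T : KappaTree κ} (hT : T.Bounded) (x : T.carrier) :
    height x < κ.ord := by
  by_contra! h
  exact hT (T.isForest.exists_branch (C := {x}) (Set.subsingleton_singleton.isChain)
    fun a ha => ⟨x, rfl, ha.le.trans h⟩)

/-- The `κ`-Tree of decreasing lists in `A` along a ladder. -/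
noncomputable def ofLadder (hκ : ℵ₀ ≤ κ) {c : ℕ → κ.ord.ToType} (hc : IsLadder c) (A : Type)
    [LinearOrder A] [Infinite A] (hA : #A ≤ κ) : KappaTree κ :=
  have : Nonempty κ.ord.ToType :=
    Ordinal.nonempty_toType_iff.2 (Cardinal.isSuccLimit_ord hκ).ne_bot
  letI : OrderBot κ.ord.ToType := WellFoundedLT.toOrderBot _
  { carrier := DescNode c A
    str := inferInstance
    card_eq := DescNode.mk_eq hc hκ (by simp) hA
    root := (DescNode.exists_root hc).choose
    root_le := (DescNode.exists_root hc).choose_spec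
    predWellOrder := DescNode.isWellOrder_Iio
    height_eq := by
      refine (iSup_congr fun p => DescNode.type_Iio_eq hc p).trans ?_
      apply le_antisymm
      · exact Ordinal.iSup_le fun p => (Ordinal.typein_lt_self _).le
      · refine (Cardinal.isSuccLimit_ord hκ).isSuccPrelimit.le_iff_forall_le.2 fun o ho => ?_
        obtain ⟨x, rfl⟩ := Ordinal.typein_surj (α := κ.ord.ToType) LT.lt
          (ho.trans_eq (Ordinal.type_toType _).symm)
        obtain ⟨p, rfl⟩ := DescNode.exists_level_eq (A := A) hc x
        exact Ordinal.le_iSup (fun p : DescNode c A => Ordinal.typein LT.lt p.level) p }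

theorem isWellFounded_climbs {c : ℕ → κ.ord.ToType} (hc : IsLadder c) {T : KappaTree κ}
    (hT : T.Bounded) :
    IsWellFounded (T.carrier × ℕ) (Climbs fun n => Ordinal.typein LT.lt (c n)) := by
  refine T.isForest.wellFounded_climbs hT (fun m n hmn => ?_) fun o ho => ?_
  · exact (Ordinal.typein_le_typein' _).2 (hc.strictMono.monotone hmn)
  · obtain ⟨x, rfl⟩ := Ordinal.typein_surj (α := κ.ord.ToType) LT.lt
      (ho.trans_eq (Ordinal.type_toType _).symm)
    obtain ⟨n, hn⟩ := hc.exists_lt x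
    exact ⟨n, (Ordinal.typein_le_typein' _).2 hn.le⟩

section ofLadder

variable (hκ : ℵ₀ ≤ κ) {c : ℕ → κ.ord.ToType} (hc : IsLadder c) {A : Type} [LinearOrder A]
  [Infinite A] (hA : #A ≤ κ)

theorem ofLadder_bounded [WellFoundedLT A] : (ofLadder hκ hc A hA).Bounded := by
  rintro ⟨f, hf⟩
  let pos : κ.ord.ToType → {o : Ordinal // o < κ.ord} := fun x =>
    ⟨Ordinal.typein LT.lt x, Ordinal.typein_lt_self x⟩
  have hmono : StrictMono fun x => (f (pos x) : DescNode c A) := fun x y hxy =>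
    hf _ _ ((Ordinal.typein_lt_typein (α := κ.ord.ToType) LT.lt).2 hxy)
  refine DescNode.not_exists_branch hc ⟨_, hmono, fun x => ?_⟩
  exact (DescNode.level_strictMono.comp hmono).le_apply

theorem reduction_ofLadder {T : KappaTree κ} (hT : T.Bounded) (ρ : T.carrier × ℕ → A)
    (hρ : ∀ q p, Climbs (fun n => Ordinal.typein LT.lt (c n)) q p → ρ q < ρ p) :
    T.Reduction (ofLadder hκ hc A hA) := by
  obtain ⟨f, hf⟩ := DescNode.exists_strictMono hc T.isForest
    (fun x => (hT.height_lt x).trans_eq (Ordinal.type_toType _).symm) ρ hρ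
  exact ⟨f, fun x y h => hf h⟩

theorem exists_typein_le_rank_of_reduction [WellFoundedLT A] {T : KappaTree κ}
    [IsWellFounded (T.carrier × ℕ) (Climbs fun n => Ordinal.typein LT.lt (c n))]
    (h : (ofLadder hκ hc A hA).Reduction T) (a : A) :
    ∃ p : T.carrier × ℕ, Ordinal.typein LT.lt a ≤
      IsWellFounded.rank (Climbs fun n => Ordinal.typein LT.lt (c n)) p := by
  obtain ⟨f, hf⟩ := h
  let p : DescNode c A := ⟨(c 0, [a]), List.pairwise_singleton _ _, fun i => by
    simp [hc.strictMono.le_iff_le]⟩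
  exact ⟨_, DescNode.typein_le_rank_climbs hc (f := f) (fun x y h => hf x y h) a [] p rfl rfl⟩

end ofLadder

end KappaTree

theorem mk_toType_ord_add_le {κ : Cardinal.{0}} (hκ : ℵ₀ ≤ κ) {o : Ordinal.{0}}
    (ho : o < (Order.succ κ).ord) : #(κ.ord + o).ToType ≤ κ := by
  rw [Cardinal.lt_ord, Order.lt_succ_iff] at ho
  rw [Cardinal.mk_toType, Ordinal.card_add, Cardinal.card_ord]
  exact Cardinal.add_le_of_le hκ le_rfl ho

theorem infinite_toType_ord_add {κ : Cardinal.{0}} (hκ : ℵ₀ ≤ κ) (o : Ordinal.{0}) :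
    Infinite (κ.ord + o).ToType := by
  rw [Cardinal.infinite_iff, Cardinal.mk_toType, Ordinal.card_add, Cardinal.card_ord]
  exact hκ.trans (self_le_add_right _ _)

open KappaTree in
/-- For `κ` a singular cardinal of cofinality `ω`, the universality number of bounded
`κ`-Trees under reduction is exactly `κ⁺`: there is a family of `κ⁺` many bounded
`κ`-Trees such that every bounded `κ`-Tree reduces into a member of it, and no family of
at most `κ` many bounded `κ`-Trees has this property. -/
theorem universality_number_bounded_kappa_trees (κ : Cardinal.{0})
    (hsing : ℵ₀ < κ) (hcof : κ.ord.cof = ℵ₀) :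
    (∃ F : (Order.succ κ).out → KappaTree κ,
      (∀ i, (F i).Bounded) ∧
      ∀ T : KappaTree κ, T.Bounded → ∃ i, T.Reduction (F i)) ∧
    ¬∃ (ι : Type) (F : ι → KappaTree κ), #ι ≤ κ ∧
      (∀ i, (F i).Bounded) ∧
      ∀ T : KappaTree κ, T.Bounded → ∃ i, T.Reduction (F i) := by
  have hκ : ℵ₀ ≤ κ := hsing.le
  have hlim : Order.IsSuccLimit (Order.succ κ).ord :=
    Cardinal.isSuccLimit_ord (hκ.trans (Order.le_succ κ))
  have hmk (T : KappaTree κ) : #(T.carrier × ℕ) ≤ κ := by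
    simp [T.card_eq, Cardinal.mul_aleph0_eq hκ]
  have hsup {ι : Type} (hι : #ι ≤ κ) (g : ι → Ordinal.{0}) (hg : ∀ i, g i < (Order.succ κ).ord) :
      ⨆ i, Order.succ (g i) < (Order.succ κ).ord := by
    refine Ordinal.iSup_lt_of_lt_cof ?_ fun i => hlim.succ_lt (hg i)
    rw [(Cardinal.isRegular_succ hκ).cof_ord]
    exact Order.lt_succ_of_le hι
  have : NoMaxOrder κ.ord.ToType := by
    have := Cardinal.noMaxOrder hκ
    exact this
  have : Nonempty κ.ord.ToType :=
    Ordinal.nonempty_toType_iff.2 (Cardinal.isSuccLimit_ord hκ).ne_bot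
  obtain ⟨c, hc⟩ : ∃ c : ℕ → κ.ord.ToType, IsLadder c :=
    exists_isLadder (by rw [Ordinal.cof_toType, hcof])
  have := infinite_toType_ord_add hκ
  let U (o : Ordinal.{0}) (ho : o < (Order.succ κ).ord) : KappaTree κ :=
    ofLadder hκ hc (κ.ord + o).ToType (mk_toType_ord_add_le hκ ho)
  constructor
  · obtain ⟨e⟩ : Nonempty ((Order.succ κ).out ≃ (Order.succ κ).ord.ToType) :=
      Cardinal.eq.1 (by simp)
    refine ⟨fun i => U (Ordinal.typein LT.lt (e i)) (Ordinal.typein_lt_self _),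
      fun i => ofLadder_bounded _ _ _, fun T hT => ?_⟩
    have := isWellFounded_climbs hc hT
    let r := IsWellFounded.rank (α := T.carrier × ℕ) (Climbs fun n => Ordinal.typein LT.lt (c n))
    have hlt := hsup (hmk T) r fun p => rank_lt_ord_succ _ (hmk T) p
    obtain ⟨x, hx⟩ := Ordinal.typein_surj (α := (Order.succ κ).ord.ToType) LT.lt
      (hlt.trans_eq (Ordinal.type_toType _).symm)
    refine ⟨e.symm x, ?_⟩
    simp only [Equiv.apply_symm_apply]
    have hr : ∀ p, r p < κ.ord + Ordinal.typein LT.lt x := fun p => by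
      rw [hx]
      exact (Order.lt_succ _).trans_le
        ((Ordinal.le_iSup (fun p => Order.succ (r p)) p).trans le_add_self)
    exact reduction_ofLadder hκ hc _ hT (fun p => Ordinal.ToType.mk ⟨r p, hr p⟩) fun q p h =>
      Ordinal.ToType.mk.lt_iff_lt.2 (IsWellFounded.rank_lt_of_rel h)
  · rintro ⟨ι, F, hι, hF, huniv⟩
    have hwf i := isWellFounded_climbs hc (hF i)
    let r (p : Σ i, (F i).carrier × ℕ) : Ordinal.{0} :=
      IsWellFounded.rank (Climbs fun n => Ordinal.typein LT.lt (c n)) p.2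
    have hcard : #(Σ i, (F i).carrier × ℕ) ≤ κ := by
      rw [Cardinal.mk_sigma]
      calc Cardinal.sum (fun i => #((F i).carrier × ℕ)) ≤ Cardinal.sum fun _ : ι => κ :=
            Cardinal.sum_le_sum _ _ fun i => hmk (F i)
        _ ≤ κ * κ := by
          rw [Cardinal.sum_const']
          gcongr
        _ = κ := Cardinal.mul_eq_self hκ
    have hβ := hsup hcard r fun p => rank_lt_ord_succ _ (hmk (F p.1)) p.2
    set β := ⨆ p, Order.succ (r p)
    obtain ⟨i, hi⟩ := huniv (U (Order.succ β) (hlim.succ_lt hβ)) (ofLadder_bounded _ _ _)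
    have hmem : β < κ.ord + Order.succ β := (Order.lt_succ β).trans_le le_add_self
    obtain ⟨a, ha⟩ := Ordinal.typein_surj (α := (κ.ord + Order.succ β).ToType) LT.lt
      (hmem.trans_eq (Ordinal.type_toType _).symm)
    obtain ⟨p, hp⟩ := exists_typein_le_rank_of_reduction hκ hc _ hi a
    rw [ha] at hp
    exact hp.not_gt ((Order.lt_succ _).trans_le
      (Ordinal.le_iSup (fun p => Order.succ (r p)) ⟨i, p⟩))
end
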